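/- arXiv:2510.02397 — 2 statements merged into one kernel-verified Lean document; each statement's English description precedes it below -/
import Mathlib

section
/- Let β(x, y) := (−y, x). For all positive integers k and m, ∫_{[0,1]²} Ψ_{k,m}(x,y) · (β(x,y) · ∇Ψ_{k,m}(x,y)) d(x,y) = 0, where β·∇Ψ = −y ∂_x Ψ + x ∂_y Ψ; and for all positive integers k and n, ∫_{[0,1]²} Ψ_{n,n}(x,y) · (β(x,y) · ∇Ψ_{k,k}(x,y)) d(x,y) = 0. Hence the matrix elements C_{(n,l),(k,m)} of the Coriolis term in the modal decomposition vanish when (n,l) = (k,m) and when n = l, k = m, so the first-order (in ω/c) contribution of rotation to each eigenvalue of the unit square vanishes. -/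
open Real MeasureTheory

/-- The iterated integral over a square of a sum of two separable continuous functions. -/
lemma integral_integral_mul_add_mul {f g h j : ℝ → ℝ} (hf : Continuous f) (hg : Continuous g)
    (hh : Continuous h) (hj : Continuous j) (a b : ℝ) :
    ∫ x in Set.Icc a b, ∫ y in Set.Icc a b, (f x * g y + h x * j y)
      = (∫ x in Set.Icc a b, f x) * (∫ y in Set.Icc a b, g y)
        + (∫ x in Set.Icc a b, h x) * (∫ y in Set.Icc a b, j y) := by
  have inner (x : ℝ) : ∫ y in Set.Icc a b, (f x * g y + h x * j y)
      = f x * (∫ y in Set.Icc a b, g y) + h x * (∫ y in Set.Icc a b, j y) := by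
    rw [integral_add (hg.integrableOn_Icc.const_mul _) (hj.integrableOn_Icc.const_mul _),
      integral_const_mul, integral_const_mul]
  simp_rw [inner]
  rw [integral_add (hf.integrableOn_Icc.mul_const _) (hh.integrableOn_Icc.mul_const _),
    integral_mul_const, integral_mul_const]

lemma hasDerivAt_sin_const_mul (c x : ℝ) :
    HasDerivAt (fun t => sin (c * t)) (c * cos (c * x)) x := by
  simpa [mul_comm] using ((hasDerivAt_id x).const_mul c).sin

lemma integral_sin_mul_deriv_sin (k : ℕ) :
    ∫ x in Set.Icc (0 : ℝ) 1, sin (k * π * x) * (k * π * cos (k * π * x)) = 0 := by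
  rw [integral_Icc_eq_integral_Ioc, ← intervalIntegral.integral_of_le zero_le_one]
  have hderiv (x : ℝ) : HasDerivAt (fun t => sin (k * π * t) ^ 2 / 2)
      (sin (k * π * x) * (k * π * cos (k * π * x))) x := by
    refine (((hasDerivAt_sin_const_mul (k * π) x).fun_pow 2).div_const 2).congr_deriv ?_
    push_cast
    ring
  rw [intervalIntegral.integral_eq_sub_of_hasDerivAt (fun x _ => hderiv x)
    (Continuous.intervalIntegrable (by fun_prop) _ _)]
  simp [sin_nat_mul_pi]

/-- The Coriolis matrix elements of the unit square in terms of one-dimensional integrals. -/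
lemma coriolis_matrix_element_eq
    (Ψ : ℕ → ℕ → ℝ → ℝ → ℝ)
    (hΨ : ∀ k m x y, Ψ k m x y = Real.sin (k * π * x) * Real.sin (m * π * y)) (n l k m : ℕ) :
    ∫ x in Set.Icc (0:ℝ) 1, ∫ y in Set.Icc (0:ℝ) 1,
        Ψ n l x y * (-y * deriv (fun x' => Ψ k m x' y) x
                      + x * deriv (fun y' => Ψ k m x y') y)
      = (∫ x in Set.Icc (0:ℝ) 1, sin (n * π * x) * (k * π * cos (k * π * x)))
          * (∫ y in Set.Icc (0:ℝ) 1, -(y * (sin (l * π * y) * sin (m * π * y))))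
        + (∫ x in Set.Icc (0:ℝ) 1, x * (sin (n * π * x) * sin (k * π * x)))
          * (∫ y in Set.Icc (0:ℝ) 1, sin (l * π * y) * (m * π * cos (m * π * y))) := by
  rw [← integral_integral_mul_add_mul (by fun_prop) (by fun_prop) (by fun_prop) (by fun_prop)]
  congr! 4 with x y
  have hx : deriv (fun x' => Ψ k m x' y) x = k * π * cos (k * π * x) * sin (m * π * y) := by
    simp_rw [hΨ]
    exact ((hasDerivAt_sin_const_mul (k * π) x).mul_const _).deriv
  have hy : deriv (fun y' => Ψ k m x y') y = sin (k * π * x) * (m * π * cos (m * π * y)) := by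
    simp_rw [hΨ]
    exact ((hasDerivAt_sin_const_mul (m * π) y).const_mul _).deriv
  rw [hx, hy, hΨ]
  ring

/-- Vanishing of the diagonal Coriolis matrix elements
`C_{(k,m),(k,m)}` and `C_{(n,n),(k,k)}` for the rotating unit square:
the first-order contribution of rotation to the eigenvalues vanishes. -/
theorem coriolis_diagonal_matrix_elements_vanish
    (Ψ : ℕ → ℕ → ℝ → ℝ → ℝ)
    (hΨ : ∀ k m x y, Ψ k m x y = Real.sin (k * π * x) * Real.sin (m * π * y)) :
    (∀ k m : ℕ, 0 < k → 0 < m →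
      ∫ x in Set.Icc (0:ℝ) 1, ∫ y in Set.Icc (0:ℝ) 1,
        Ψ k m x y * (-y * deriv (fun x' => Ψ k m x' y) x
                      + x * deriv (fun y' => Ψ k m x y') y) = 0)
    ∧ (∀ k n : ℕ, 0 < k → 0 < n →
      ∫ x in Set.Icc (0:ℝ) 1, ∫ y in Set.Icc (0:ℝ) 1,
        Ψ n n x y * (-y * deriv (fun x' => Ψ k k x' y) x
                      + x * deriv (fun y' => Ψ k k x y') y) = 0) := by
  refine ⟨fun k m _ _ => ?_, fun k n _ _ => ?_⟩
  · rw [coriolis_matrix_element_eq Ψ hΨ, integral_sin_mul_deriv_sin, integral_sin_mul_deriv_sin]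
    ring
  · rw [coriolis_matrix_element_eq Ψ hΨ, integral_neg]
    ring
end

section
/- Let W ∈ M₂ₙ(ℂ) be Hamiltonian, i.e. (W·J)ᵀ = W·J where J := [[0, Iₙ], [−Iₙ, 0]], and let σ ∈ ℂ with σ² ∈ ℝ (equivalently, σ is real or purely imaginary) be such that W − σI and W + σI are invertible. Then R₂(σ, W) := (W − σI)⁻¹(W + σI)⁻¹ equals (W² − σ²I)⁻¹ and is skew-Hamiltonian: (R₂(σ,W)·J)ᵀ = −R₂(σ,W)·J. In particular, for σ = 0, W⁻² is skew-Hamiltonian. -/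
open Matrix

/-- The square of a Hamiltonian matrix, shifted by a scalar, is skew-Hamiltonian. -/
theorem Matrix.transpose_sq_sub_smul_mul_eq_neg {m R : Type*} [Fintype m] [DecidableEq m]
    [CommRing R] {W J : Matrix m m R} (hJ : Jᵀ = -J) (hW : (W * J)ᵀ = W * J) (c : R) :
    ((W * W - c • 1) * J)ᵀ = -((W * W - c • 1) * J) := by
  have hJW : J * Wᵀ = -(W * J) := by
    rw [← hW, transpose_mul, hJ, neg_mul, neg_neg]
  have hJWW : J * (Wᵀ * Wᵀ) = W * W * J := by
    rw [← mul_assoc, hJW, neg_mul, mul_assoc, hJW, mul_neg, neg_neg, mul_assoc]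
  simp [transpose_mul, hJ, sub_mul, hJWW, neg_add_eq_sub]

/-- The inverse of a skew-Hamiltonian matrix is skew-Hamiltonian. -/
theorem Matrix.transpose_inv_mul_eq_neg {m R : Type*} [Fintype m] [DecidableEq m]
    [CommRing R] {A J : Matrix m m R} (hJ : Jᵀ = -J) (hJJ : J * J = -1)
    (hA : (A * J)ᵀ = -(A * J)) : (A⁻¹ * J)ᵀ = -(A⁻¹ * J) := by
  have hJinv : J⁻¹ = -J := inv_eq_right_inv (by rw [mul_neg, hJJ, neg_neg])
  have hJA : J * Aᵀ = A * J := by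
    rwa [transpose_mul, hJ, neg_mul, neg_inj] at hA
  have hinv : A⁻¹ᵀ * J = J * A⁻¹ := by
    have h := congrArg (·⁻¹) hJA
    simpa only [mul_inv_rev, hJinv, mul_neg, neg_mul, neg_inj, ← transpose_nonsing_inv] using h
  have hJAinv : J * A⁻¹ᵀ = A⁻¹ * J := by
    have h := congrArg (fun X => J * X * J) hinv
    simpa only [mul_assoc, hJJ, mul_neg, mul_one, neg_inj, ← mul_assoc J J, neg_mul, one_mul]
      using h
  rw [transpose_mul, hJ, neg_mul, hJAinv]

/-- The SHIRA shift operator: if `W` is Hamiltonian and `σ² ∈ ℝ` with `W ± σI`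
invertible, then `R₂(σ,W) = (W − σI)⁻¹(W + σI)⁻¹ = (W² − σ²I)⁻¹` is
skew-Hamiltonian; in particular for `σ = 0` the matrix `W⁻²` is skew-Hamiltonian. -/
theorem shira_shift_skew_hamiltonian
    (n : ℕ) (hn : 0 < n)
    (W J : Matrix (Fin n ⊕ Fin n) (Fin n ⊕ Fin n) ℂ)
    (hJ : J = Matrix.fromBlocks 0 1 (-1) 0)
    (hW : (W * J)ᵀ = W * J)
    (σ : ℂ) (hσ : ∃ x : ℝ, σ^2 = (x : ℂ))
    (h₁ : IsUnit (W - σ • (1 : Matrix (Fin n ⊕ Fin n) (Fin n ⊕ Fin n) ℂ)))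
    (h₂ : IsUnit (W + σ • (1 : Matrix (Fin n ⊕ Fin n) (Fin n ⊕ Fin n) ℂ)))
    (R₂ : Matrix (Fin n ⊕ Fin n) (Fin n ⊕ Fin n) ℂ)
    (hR₂ : R₂ = (W - σ • 1)⁻¹ * (W + σ • 1)⁻¹) :
    R₂ = (W * W - σ^2 • 1)⁻¹
    ∧ (R₂ * J)ᵀ = -(R₂ * J)
    ∧ (σ = 0 → ((W⁻¹ * W⁻¹) * J)ᵀ = -((W⁻¹ * W⁻¹) * J)) := by
  have hJt : Jᵀ = -J := by
    simp [hJ, fromBlocks_transpose, fromBlocks_neg]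
  have hJJ : J * J = -1 := by
    rw [hJ, fromBlocks_multiply, ← fromBlocks_one, fromBlocks_neg]
    simp
  have hR : R₂ = (W * W - σ^2 • 1)⁻¹ := by
    rw [hR₂, ← Matrix.mul_inv_rev]
    congr 1
    simp only [add_mul, mul_sub, smul_mul_assoc, mul_smul_comm, one_mul, mul_one, smul_add,
      smul_smul, pow_two]
    abel
  have hskew : (R₂ * J)ᵀ = -(R₂ * J) :=
    hR ▸ transpose_inv_mul_eq_neg hJt hJJ (transpose_sq_sub_smul_mul_eq_neg hJt hW _)
  refine ⟨hR, hskew, ?_⟩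
  rintro rfl
  simpa [hR₂] using hskew
end
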